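/- Let p(ρ) = ρ^γ with γ > 1, λ₀⁻ = −√(p'(ρ̄)) and λ₃⁺ = +√(p'(ρ̄)). Let α₀, α₁, α₂, α₃ ∈ ℝ with max_i |α_i| ≤ ϵ, and define ρ̃ = ρ̄ + α₀ ϑ₋ + α₃ ϑ₊, m̃_i = ρ̄ ū_i θ + ū_i (α₃ ϑ₊ − α₀ ϑ₋) + α_i ϑ for i = 1,2, m̃₃ = λ₀⁻ α₀ ϑ₋ + λ₃⁺ α₃ ϑ₊, ũ = m̃/ρ̃, u^vs = θ ū, and the error terms F = α₀ ∂₃ϑ₋ + α₃ ∂₃ϑ₊; G_i = α_i ∂₃ϑ + [ m̃₃ m̃_i/ρ̃ + ū_i(α₀ λ₀⁻ ϑ₋ − α₃ λ₃⁺ ϑ₊) ] − ū_i(α₀ ∂₃ϑ₋ − α₃ ∂₃ϑ₊) − μ ∂₃(ũ_i − u_i^vs) for i = 1,2; G₃ = m̃₃²/ρ̃ + [ p(ρ̃) − p(ρ̄) − p'(ρ̄)(ρ̃ − ρ̄) ] − (2μ+λ) ∂₃ũ₃ + λ₀⁻ α₀ ∂₃ϑ₋ + λ₃⁺ α₃ ∂₃ϑ₊.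 Then there exist ϵ₀ > 0, c₀ > 0 and, for each integer j ≥ 0, a constant C_j > 0 (all independent of ϵ, x₃ and t) such that if ϵ ≤ ϵ₀, then for all x₃ ∈ ℝ, t ≥ 0 and j = 0,1,2,…: |∂₃^j F(x₃,t)| + |∂₃^j G(x₃,t)| ≤ C_j ϵ (t+Λ)^{−1−j/2} 𝔈(x₃,t), where 𝔈 = e^{−c₀ x₃²/(t+Λ)} + e^{−c₀ |x₃ − λ₀⁻(t+Λ)|²/(t+Λ)} + e^{−c₀ |x₃ − λ₃⁺(t+Λ)|²/(t+Λ)}. -/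

import Mathlib

open Real MeasureTheory Filter Topology

/-- The self-similar profile `Θ(ξ) = (2/√π) ∫₀^{(1/2)√(ρ̄/μ) ξ} e^{-η²} dη`. -/
noncomputable def Theta (ρb μ : ℝ) (ξ : ℝ) : ℝ :=
  (2 / Real.sqrt Real.pi) * ∫ η in (0:ℝ)..((1/2) * Real.sqrt (ρb/μ) * ξ), Real.exp (-η^2)

/-- `θ(x₃,t) = Θ(x₃/√(t+Λ))`. -/
noncomputable def theta (ρb μ Λ : ℝ) (x t : ℝ) : ℝ :=
  Theta ρb μ (x / Real.sqrt (t + Λ))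

/-- The heat kernel profile `ϑ(x₃,t) = (2√(π(t+Λ)))⁻¹ exp(-x₃²/(4(t+Λ)))`. -/
noncomputable def vtheta (Λ : ℝ) (x t : ℝ) : ℝ :=
  (1 / (2 * Real.sqrt (Real.pi * (t + Λ)))) * Real.exp (-x^2 / (4 * (t + Λ)))

/-- The transversal characteristic speed `λ₀⁻ = -√(p'(ρ̄)) = -√(γρ̄^{γ-1})`. -/
noncomputable def lam0 (ρb γ : ℝ) : ℝ := -Real.sqrt (γ * ρb ^ (γ - 1))

/-- The transversal characteristic speed `λ₃⁺ = √(p'(ρ̄)) = √(γρ̄^{γ-1})`. -/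
noncomputable def lam3 (ρb γ : ℝ) : ℝ := Real.sqrt (γ * ρb ^ (γ - 1))

/-- The diffusion wave `ϑ₋(x₃,t) = ϑ(x₃ - λ₀⁻(t+Λ), t)`. -/
noncomputable def vthm (ρb γ Λ : ℝ) (x t : ℝ) : ℝ :=
  vtheta Λ (x - lam0 ρb γ * (t + Λ)) t

/-- The diffusion wave `ϑ₊(x₃,t) = ϑ(x₃ - λ₃⁺(t+Λ), t)`. -/
noncomputable def vthp (ρb γ Λ : ℝ) (x t : ℝ) : ℝ :=
  vtheta Λ (x - lam3 ρb γ * (t + Λ)) t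

/-- The ansatz density `ρ̃ = ρ̄ + α₀ϑ₋ + α₃ϑ₊`. -/
noncomputable def rhoT (ρb γ Λ α₀ α₃ : ℝ) (x t : ℝ) : ℝ :=
  ρb + α₀ * vthm ρb γ Λ x t + α₃ * vthp ρb γ Λ x t

/-- The ansatz transverse momentum `m̃ᵢ = ρ̄ūᵢθ + ūᵢ(α₃ϑ₊ - α₀ϑ₋) + αᵢϑ`, `i = 1,2`. -/
noncomputable def miT (ρb μ γ Λ ubi αi α₀ α₃ : ℝ) (x t : ℝ) : ℝ :=
  ρb * ubi * theta ρb μ Λ x t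
    + ubi * (α₃ * vthp ρb γ Λ x t - α₀ * vthm ρb γ Λ x t) + αi * vtheta Λ x t

/-- The ansatz normal momentum `m̃₃ = λ₀⁻α₀ϑ₋ + λ₃⁺α₃ϑ₊`. -/
noncomputable def m3T (ρb γ Λ α₀ α₃ : ℝ) (x t : ℝ) : ℝ :=
  lam0 ρb γ * α₀ * vthm ρb γ Λ x t + lam3 ρb γ * α₃ * vthp ρb γ Λ x t

/-- The error term `F = α₀∂₃ϑ₋ + α₃∂₃ϑ₊`. -/
noncomputable def errF (ρb γ Λ α₀ α₃ : ℝ) (x t : ℝ) : ℝ :=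
  α₀ * deriv (fun y => vthm ρb γ Λ y t) x + α₃ * deriv (fun y => vthp ρb γ Λ y t) x

/-- The error term `Gᵢ`, `i = 1,2`. -/
noncomputable def errGi (ρb μ γ Λ ubi αi α₀ α₃ : ℝ) (x t : ℝ) : ℝ :=
  αi * deriv (fun y => vtheta Λ y t) x
    + (m3T ρb γ Λ α₀ α₃ x t * miT ρb μ γ Λ ubi αi α₀ α₃ x t / rhoT ρb γ Λ α₀ α₃ x t
        + ubi * (α₀ * lam0 ρb γ * vthm ρb γ Λ x t - α₃ * lam3 ρb γ * vthp ρb γ Λ x t))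
    - ubi * (α₀ * deriv (fun y => vthm ρb γ Λ y t) x
        - α₃ * deriv (fun y => vthp ρb γ Λ y t) x)
    - μ * deriv (fun y =>
        miT ρb μ γ Λ ubi αi α₀ α₃ y t / rhoT ρb γ Λ α₀ α₃ y t
          - theta ρb μ Λ y t * ubi) x

/-- The error term `G₃`. -/
noncomputable def errG3 (ρb μ lam γ Λ α₀ α₃ : ℝ) (x t : ℝ) : ℝ :=
  (m3T ρb γ Λ α₀ α₃ x t)^2 / rhoT ρb γ Λ α₀ α₃ x t
    + ((rhoT ρb γ Λ α₀ α₃ x t) ^ γ - ρb ^ γ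
        - γ * ρb ^ (γ - 1) * (rhoT ρb γ Λ α₀ α₃ x t - ρb))
    - (2*μ + lam) * deriv (fun y => m3T ρb γ Λ α₀ α₃ y t / rhoT ρb γ Λ α₀ α₃ y t) x
    + lam0 ρb γ * α₀ * deriv (fun y => vthm ρb γ Λ y t) x
    + lam3 ρb γ * α₃ * deriv (fun y => vthp ρb γ Λ y t) x

/-- The Gaussian envelope `𝔈`. -/
noncomputable def envE (ρb γ Λ c₀ : ℝ) (x t : ℝ) : ℝ :=
  Real.exp (-c₀ * x^2 / (t + Λ))
    + Real.exp (-c₀ * (x - lam0 ρb γ * (t + Λ))^2 / (t + Λ))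
    + Real.exp (-c₀ * (x - lam3 ρb γ * (t + Λ))^2 / (t + Λ))

open scoped ContDiff

/-- Symbol-type bounds up to order `n` for a family `f` of smooth functions on the length scale `s`:
each derivative gains a factor `s⁻¹`, uniformly in the index of the family. -/
def ScaledBound {ι : Type*} (s : ι → ℝ) (n : ℕ) (f w : ι → ℝ → ℝ) : Prop :=
  (∀ i, ContDiff ℝ ∞ (f i)) ∧
    ∀ j ≤ n, ∃ C : ℝ, 0 ≤ C ∧ ∀ i x, |iteratedDeriv j (f i) x| ≤ C * (s i)⁻¹ ^ j * w i x

namespace ScaledBound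

variable {ι : Type*} {s : ι → ℝ} {n : ℕ} {f g w v : ι → ℝ → ℝ}

lemma contDiffAt (hf : ScaledBound s n f w) (i : ι) (j : ℕ) (x : ℝ) : ContDiffAt ℝ j (f i) x :=
  ((hf.1 i).of_le (by exact_mod_cast le_top)).contDiffAt

lemma add (hf : ScaledBound s n f w) (hg : ScaledBound s n g w) :
    ScaledBound s n (fun i x => f i x + g i x) w := by
  refine ⟨fun i => (hf.1 i).add (hg.1 i), fun j hj => ?_⟩
  obtain ⟨C, hC, hfC⟩ := hf.2 j hj
  obtain ⟨D, hD, hgD⟩ := hg.2 j hj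
  refine ⟨C + D, by positivity, fun i x => ?_⟩
  rw [iteratedDeriv_fun_add (hf.contDiffAt i j x) (hg.contDiffAt i j x)]
  refine (abs_add_le _ _).trans ?_
  linarith [hfC i x, hgD i x]

lemma mul (hf : ScaledBound s n f w) (hg : ScaledBound s n g v) :
    ScaledBound s n (fun i x => f i x * g i x) (fun i x => w i x * v i x) := by
  refine ⟨fun i => (hf.1 i).mul (hg.1 i), fun j hj => ?_⟩
  have hf' : ∀ k, ∃ C : ℝ, k ≤ j → 0 ≤ C ∧
      ∀ i x, |iteratedDeriv k (f i) x| ≤ C * (s i)⁻¹ ^ k * w i x := fun k => by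
    by_cases hk : k ≤ j
    · obtain ⟨C, h⟩ := hf.2 k (hk.trans hj)
      exact ⟨C, fun _ => h⟩
    · exact ⟨0, fun h => absurd h hk⟩
  have hg' : ∀ k, ∃ C : ℝ, k ≤ j → 0 ≤ C ∧
      ∀ i x, |iteratedDeriv k (g i) x| ≤ C * (s i)⁻¹ ^ k * v i x := fun k => by
    by_cases hk : k ≤ j
    · obtain ⟨C, h⟩ := hg.2 k (hk.trans hj)
      exact ⟨C, fun _ => h⟩
    · exact ⟨0, fun h => absurd h hk⟩
  choose C hC using hf'
  choose D hD using hg'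
  refine ⟨∑ k ∈ Finset.range (j + 1), j.choose k * C k * D (j - k),
    Finset.sum_nonneg fun k hk => ?_, fun i x => ?_⟩
  · have hk : k ≤ j := Nat.lt_succ_iff.1 (Finset.mem_range.1 hk)
    have := (hC k hk).1
    have := (hD (j - k) (Nat.sub_le _ _)).1
    positivity
  rw [iteratedDeriv_fun_mul (hf.contDiffAt i j x) (hg.contDiffAt i j x), Finset.sum_mul,
    Finset.sum_mul]
  refine (Finset.abs_sum_le_sum_abs _ _).trans (Finset.sum_le_sum fun k hk => ?_)
  have hk : k ≤ j := Nat.lt_succ_iff.1 (Finset.mem_range.1 hk)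
  have h1 := (hC k hk).2 i x
  have h2 := (hD (j - k) (Nat.sub_le _ _)).2 i x
  rw [abs_mul, abs_mul, Nat.abs_cast, mul_assoc]
  calc (j.choose k : ℝ) * (|iteratedDeriv k (f i) x| * |iteratedDeriv (j - k) (g i) x|)
      ≤ j.choose k * ((C k * (s i)⁻¹ ^ k * w i x) * (D (j - k) * (s i)⁻¹ ^ (j - k) * v i x)) := by
        gcongr
        exact (abs_nonneg _).trans h1
    _ = j.choose k * C k * D (j - k) * ((s i)⁻¹ ^ k * (s i)⁻¹ ^ (j - k)) * (w i x * v i x) := by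
        ring
    _ = _ := by rw [← pow_add, Nat.add_sub_cancel' hk]

lemma mono (hs : ∀ i, 0 < s i) (hf : ScaledBound s n f w) (K : ℝ) (hK : 0 ≤ K)
    (h : ∀ i x, w i x ≤ K * v i x) : ScaledBound s n f v := by
  refine ⟨hf.1, fun j hj => ?_⟩
  obtain ⟨C, hC, hfC⟩ := hf.2 j hj
  refine ⟨C * K, by positivity, fun i x => (hfC i x).trans ?_⟩
  have := hs i
  calc C * (s i)⁻¹ ^ j * w i x ≤ C * (s i)⁻¹ ^ j * (K * v i x) := by
        gcongr
        exact h i x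
    _ = _ := by ring


lemma const_mul (a : ι → ℝ) (hf : ScaledBound s n f w) :
    ScaledBound s n (fun i x => a i * f i x) (fun i x => |a i| * w i x) := by
  refine ⟨fun i => contDiff_const.mul (hf.1 i), fun j hj => ?_⟩
  obtain ⟨C, hC, hfC⟩ := hf.2 j hj
  refine ⟨C, hC, fun i x => ?_⟩
  rw [iteratedDeriv_const_mul _ (hf.contDiffAt i j x), abs_mul]
  calc |a i| * |iteratedDeriv j (f i) x| ≤ |a i| * (C * (s i)⁻¹ ^ j * w i x) := by
        gcongr
        exact hfC i x
    _ = _ := by ring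

lemma smul (a : ℝ) (hf : ScaledBound s n f w) : ScaledBound s n (fun i x => a * f i x) w := by
  refine ⟨fun i => contDiff_const.mul (hf.1 i), fun j hj => ?_⟩
  obtain ⟨C, hC, hfC⟩ := hf.2 j hj
  refine ⟨|a| * C, by positivity, fun i x => ?_⟩
  rw [iteratedDeriv_const_mul _ (hf.contDiffAt i j x), abs_mul, mul_assoc, mul_assoc,
    ← mul_assoc C]
  gcongr
  exact hfC i x

lemma of_le (hf : ScaledBound s n f w) {m : ℕ} (h : m ≤ n) : ScaledBound s m f w :=
  ⟨hf.1, fun j hj => hf.2 j (hj.trans h)⟩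

lemma deriv (hf : ScaledBound s (n + 1) f w) :
    ScaledBound s n (fun i => deriv (f i)) (fun i x => (s i)⁻¹ * w i x) := by
  refine ⟨fun i => (contDiff_infty_iff_deriv.1 (hf.1 i)).2, fun j hj => ?_⟩
  obtain ⟨C, hC, hfC⟩ := hf.2 (j + 1) (by lia)
  refine ⟨C, hC, fun i x => ?_⟩
  rw [← iteratedDeriv_succ']
  refine (hfC i x).trans_eq ?_
  ring

lemma zero_of_le (hf : ∀ i, ContDiff ℝ ∞ (f i)) (C : ℝ) (hC : 0 ≤ C)
    (h : ∀ i x, |f i x| ≤ C * w i x) : ScaledBound s 0 f w := by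
  refine ⟨hf, fun j hj => ⟨C, hC, fun i x => ?_⟩⟩
  obtain rfl : j = 0 := by lia
  simpa using h i x

lemma succ_of_deriv (C : ℝ) (hC : 0 ≤ C) (hf : ∀ i, Differentiable ℝ (f i))
    (h : ∀ i x, |f i x| ≤ C * w i x)
    (h' : ScaledBound s n (fun i => _root_.deriv (f i)) (fun i x => (s i)⁻¹ * w i x)) :
    ScaledBound s (n + 1) f w := by
  refine ⟨fun i => contDiff_infty_iff_deriv.2 ⟨hf i, h'.1 i⟩, fun j hj => ?_⟩
  rcases j with _ | j
  · exact ⟨C, hC, fun i x => by simpa using h i x⟩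
  · obtain ⟨D, hD, hfD⟩ := h'.2 j (by lia)
    refine ⟨D, hD, fun i x => ?_⟩
    rw [iteratedDeriv_succ']
    refine (hfD i x).trans_eq ?_
    ring

end ScaledBound

lemma exists_abs_aeval_le_exp (p : Polynomial ℤ) :
    ∃ C : ℝ, 0 ≤ C ∧ ∀ x : ℝ, |Polynomial.aeval x p| ≤ C * Real.exp (x ^ 2 / 4) := by
  induction p using Polynomial.induction_on' with
  | add p q hp hq =>
    obtain ⟨C, hC, hp⟩ := hp
    obtain ⟨D, hD, hq⟩ := hq
    refine ⟨C + D, by positivity, fun x => ?_⟩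
    rw [map_add, add_mul]
    exact (abs_add_le _ _).trans (add_le_add (hp x) (hq x))
  | monomial n a =>
    refine ⟨|(a : ℝ)| * (n.factorial * Real.exp 1), by positivity, fun x => ?_⟩
    have h := Real.pow_div_factorial_le_exp |x| (abs_nonneg x) n
    rw [div_le_iff₀ (by positivity)] at h
    have h2 : Real.exp |x| ≤ Real.exp 1 * Real.exp (x ^ 2 / 4) := by
      rw [← Real.exp_add, Real.exp_le_exp]
      nlinarith [sq_nonneg (|x| / 2 - 1), sq_abs x]
    rw [Polynomial.aeval_monomial, abs_mul, abs_pow, mul_assoc, mul_assoc]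
    have h3 : |algebraMap ℤ ℝ a| = |(a : ℝ)| := by simp
    rw [h3]
    gcongr
    nlinarith [show (0 : ℝ) ≤ n.factorial by positivity]

lemma exists_abs_iteratedDeriv_gaussian_le (j : ℕ) : ∃ C : ℝ, 0 ≤ C ∧ ∀ x : ℝ,
    |iteratedDeriv j (fun y : ℝ => Real.exp (-(y ^ 2 / 2))) x| ≤ C * Real.exp (-(x ^ 2 / 4)) := by
  obtain ⟨C, hC, h⟩ := exists_abs_aeval_le_exp (Polynomial.hermite j)
  refine ⟨C, hC, fun x => ?_⟩
  rw [iteratedDeriv_eq_iterate, Polynomial.deriv_gaussian_eq_hermite_mul_gaussian, abs_mul,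
    abs_mul, abs_pow, abs_neg, abs_one, one_pow, one_mul, abs_of_pos (Real.exp_pos _)]
  calc _ ≤ C * Real.exp (x ^ 2 / 4) * Real.exp (-(x ^ 2 / 2)) := by
        gcongr
        exact h x
    _ = _ := by
        rw [mul_assoc, ← Real.exp_add]
        ring_nf

lemma ScaledBound.gaussian {ι : Type*} {s : ι → ℝ} (hs : ∀ i, 0 < s i) (n : ℕ) {κ : ℝ}
    (hκ : 0 < κ) (a : ι → ℝ) :
    ScaledBound s n (fun i x => Real.exp (-κ * (x - a i) ^ 2 / s i ^ 2))
      (fun i x => Real.exp (-(κ / 2) * (x - a i) ^ 2 / s i ^ 2)) := by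
  set r := Real.sqrt (2 * κ) with hr
  have hr2 : r ^ 2 = 2 * κ := Real.sq_sqrt (by positivity)
  have hφ : ContDiff ℝ ∞ (fun y : ℝ => Real.exp (-(y ^ 2 / 2))) := by fun_prop
  have key : ∀ i, (fun x => Real.exp (-κ * (x - a i) ^ 2 / s i ^ 2)) =
      fun x => (fun z => (fun y : ℝ => Real.exp (-(y ^ 2 / 2))) (r * (s i)⁻¹ * z)) (x - a i) := by
    intro i
    funext x
    have := (hs i).ne'
    simp only [mul_pow, hr2]
    congr 1
    field_simp
  refine ⟨fun i => by fun_prop, fun j _ => ?_⟩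
  obtain ⟨C, hC, h⟩ := exists_abs_iteratedDeriv_gaussian_le j
  refine ⟨r ^ j * C, by positivity, fun i x => ?_⟩
  have hsi := hs i
  beta_reduce
  rw [key i, iteratedDeriv_comp_sub_const j
    (fun z => (fun y : ℝ => Real.exp (-(y ^ 2 / 2))) (r * (s i)⁻¹ * z)) (a i),
    iteratedDeriv_comp_const_mul (hφ.of_le (by exact_mod_cast le_top))]
  simp only
  rw [abs_mul, abs_of_nonneg (by positivity), mul_pow]
  calc _ ≤ r ^ j * (s i)⁻¹ ^ j * (C * Real.exp (-((r * (s i)⁻¹ * (x - a i)) ^ 2 / 4))) := by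
        gcongr
        exact h _
    _ = _ := by
        rw [mul_pow, mul_pow, hr2]
        have : -(2 * κ * (s i)⁻¹ ^ 2 * (x - a i) ^ 2 / 4) = -(κ / 2) * (x - a i) ^ 2 / s i ^ 2 := by
          field_simp
          ring
        rw [this]
        ring

section Power

lemma rpow_le_max {l u y : ℝ} (a : ℝ) (hl : 0 < l) (h1 : l ≤ y) (h2 : y ≤ u) :
    y ^ a ≤ max (l ^ a) (u ^ a) := by
  rcases le_total 0 a with ha | ha
  · exact (Real.rpow_le_rpow (hl.le.trans h1) h2 ha).trans (le_max_right _ _)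
  · exact (Real.rpow_le_rpow_of_nonpos hl h1 ha).trans (le_max_left _ _)

lemma exists_abs_rpow_sub_le {l u : ℝ} (a : ℝ) (hl : 0 < l) : ∃ C : ℝ, 0 ≤ C ∧
    ∀ x ∈ Set.Icc l u, ∀ y ∈ Set.Icc l u, |y ^ a - x ^ a| ≤ C * |y - x| := by
  refine ⟨|a| * max (l ^ (a - 1)) (u ^ (a - 1)),
    mul_nonneg (abs_nonneg _) (le_max_of_le_left (by positivity)), fun x hx y hy => ?_⟩
  refine Convex.norm_image_sub_le_of_norm_hasDerivWithin_le (f := fun z => z ^ a)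
    (f' := fun z => a * z ^ (a - 1)) (s := Set.Icc l u) (fun z hz => ?_) (fun z hz => ?_)
    (convex_Icc _ _) hx hy
  · exact (Real.hasDerivAt_rpow_const (Or.inl (hl.trans_le hz.1).ne')).hasDerivWithinAt
  · have : 0 < z := hl.trans_le hz.1
    rw [Real.norm_eq_abs, abs_mul, abs_of_pos (Real.rpow_pos_of_pos this _)]
    gcongr
    exact rpow_le_max _ hl hz.1 hz.2

lemma exists_abs_rpow_taylor_le {l u : ℝ} (a : ℝ) (hl : 0 < l) : ∃ C : ℝ, 0 ≤ C ∧
    ∀ x ∈ Set.Icc l u, ∀ y ∈ Set.Icc l u,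
      |y ^ a - x ^ a - a * x ^ (a - 1) * (y - x)| ≤ C * (y - x) ^ 2 := by
  obtain ⟨C, hC, h⟩ := exists_abs_rpow_sub_le (l := l) (u := u) (a - 1) hl
  refine ⟨|a| * C, by positivity, fun x hx y hy => ?_⟩
  have hsub : Set.uIcc x y ⊆ Set.Icc l u := Set.uIcc_subset_Icc hx hy
  have := Convex.norm_image_sub_le_of_norm_hasDerivWithin_le
    (f := fun z => z ^ a - a * x ^ (a - 1) * z)
    (f' := fun z => a * z ^ (a - 1) - a * x ^ (a - 1)) (s := Set.uIcc x y)
    (C := |a| * (C * |y - x|)) (fun z hz => ?_) (fun z hz => ?_)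
    (convex_uIcc _ _) Set.left_mem_uIcc Set.right_mem_uIcc
  · rw [Real.norm_eq_abs, Real.norm_eq_abs] at this
    calc _ = |y ^ a - a * x ^ (a - 1) * y - (x ^ a - a * x ^ (a - 1) * x)| := by ring_nf
      _ ≤ _ := this
      _ = |a| * C * |y - x| ^ 2 := by ring
      _ = _ := by rw [sq_abs]
  · have hz0 : 0 < z := hl.trans_le (hsub hz).1
    have h1 := (Real.hasDerivAt_rpow_const (p := a) (Or.inl hz0.ne')).sub
      ((hasDerivAt_id' z).const_mul (a * x ^ (a - 1)))
    rw [mul_one] at h1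
    exact h1.hasDerivWithinAt
  · rw [Real.norm_eq_abs, ← mul_sub, abs_mul]
    gcongr
    refine (h x hx z (hsub hz)).trans ?_
    exact mul_le_mul_of_nonneg_left (Set.abs_sub_left_of_mem_uIcc hz) hC

variable {ι : Type*} {s : ι → ℝ} {l u ρ₀ : ℝ} {σ w : ι → ℝ → ℝ}

lemma hasDerivAt_add_rpow {f : ℝ → ℝ} {x : ℝ} (a : ℝ) (hf : DifferentiableAt ℝ f x)
    (h : 0 < ρ₀ + f x) :
    HasDerivAt (fun y => (ρ₀ + f y) ^ a) (deriv f x * a * (ρ₀ + f x) ^ (a - 1)) x :=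
  (hf.hasDerivAt.const_add ρ₀).rpow_const (Or.inl h.ne')

lemma ScaledBound.rpow (hl : 0 < l)
    (hσ : ∀ n, ScaledBound s n σ (fun _ _ => 1)) (h : ∀ i x, ρ₀ + σ i x ∈ Set.Icc l u) (n : ℕ) :
    ∀ a : ℝ, ScaledBound s n (fun i x => (ρ₀ + σ i x) ^ a) (fun _ _ => 1) := by
  have hpos : ∀ i x, 0 < ρ₀ + σ i x := fun i x => hl.trans_le (h i x).1
  have hcd : ∀ (a : ℝ) i, ContDiff ℝ ∞ (fun x => (ρ₀ + σ i x) ^ a) := fun a i =>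
    (contDiff_const.add ((hσ 0).1 i)).rpow_const_of_ne fun x => (hpos i x).ne'
  have hbd : ∀ (a : ℝ) i x, |(ρ₀ + σ i x) ^ a| ≤ max (l ^ a) (u ^ a) * 1 := fun a i x => by
    rw [abs_of_pos (Real.rpow_pos_of_pos (hpos i x) _), mul_one]
    exact rpow_le_max _ hl (h i x).1 (h i x).2
  have hmax : ∀ a : ℝ, 0 ≤ max (l ^ a) (u ^ a) := fun a => le_max_of_le_left (by positivity)
  induction n with
  | zero => exact fun a => zero_of_le (hcd a) _ (hmax a) (hbd a)
  | succ n ih =>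
    intro a
    refine succ_of_deriv _ (hmax a) (fun i => (hcd a i).differentiable (by simp)) (hbd a) ?_
    have := (((hσ (n + 1)).deriv).mul (ih (a - 1))).smul a
    convert this using 1
    · funext i x
      rw [(hasDerivAt_add_rpow a (((hσ 0).1 i).differentiable (by simp) x) (hpos i x)).deriv]
      ring
    · simp

lemma ScaledBound.rpow_sub (hl : 0 < l) (hρ₀ : ρ₀ ∈ Set.Icc l u)
    (hσ1 : ∀ n, ScaledBound s n σ (fun _ _ => 1)) (hσ : ∀ n, ScaledBound s n σ w)
    (h : ∀ i x, ρ₀ + σ i x ∈ Set.Icc l u) (n : ℕ) (a : ℝ) :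
    ScaledBound s n (fun i x => (ρ₀ + σ i x) ^ a - ρ₀ ^ a) w := by
  obtain ⟨C, hC, hCb⟩ := exists_abs_rpow_sub_le (l := l) (u := u) a hl
  obtain ⟨D, hD, hDb⟩ := (hσ 0).2 0 le_rfl
  refine (succ_of_deriv (C * D) (by positivity)
    (fun i => ((rpow hl hσ1 h 0 a).1 i).differentiable (by simp) |>.sub_const _)
    (fun i x => ?_) ?_ : ScaledBound s (n + 1) _ w).of_le n.le_succ
  · have h1 := hCb ρ₀ hρ₀ _ (h i x)
    have h2 := hDb i x
    simp only [iteratedDeriv_zero, pow_zero, mul_one] at h2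
    rw [add_sub_cancel_left] at h1
    refine h1.trans ?_
    rw [mul_assoc]
    gcongr
  · have := (((hσ (n + 1)).deriv).mul (rpow hl hσ1 h n (a - 1))).smul a
    convert this using 1
    · funext i x
      rw [((hasDerivAt_add_rpow a (((hσ 0).1 i).differentiable (by simp) x)
        (hl.trans_le (h i x).1)).sub_const _).deriv]
      ring
    · simp

lemma ScaledBound.rpow_taylor (hl : 0 < l) (hρ₀ : ρ₀ ∈ Set.Icc l u)
    (hσ1 : ∀ n, ScaledBound s n σ (fun _ _ => 1)) (hσ : ∀ n, ScaledBound s n σ w)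
    (h : ∀ i x, ρ₀ + σ i x ∈ Set.Icc l u) (n : ℕ) (a : ℝ) :
    ScaledBound s n (fun i x => (ρ₀ + σ i x) ^ a - ρ₀ ^ a - a * ρ₀ ^ (a - 1) * σ i x)
      (fun i x => w i x * w i x) := by
  obtain ⟨C, hC, hCb⟩ := exists_abs_rpow_taylor_le (l := l) (u := u) a hl
  obtain ⟨D, hD, hDb⟩ := (hσ 0).2 0 le_rfl
  have hd : ∀ i, Differentiable ℝ (σ i) := fun i => ((hσ 0).1 i).differentiable (by simp)
  refine (succ_of_deriv (C * D ^ 2) (by positivity)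
    (fun i => (((rpow hl hσ1 h 0 a).1 i).differentiable (by simp) |>.sub_const _).sub
      ((hd i).const_mul _)) (fun i x => ?_) ?_ :
    ScaledBound s (n + 1) _ (fun i x => w i x * w i x)).of_le n.le_succ
  · have h1 := hCb ρ₀ hρ₀ _ (h i x)
    have h2 := hDb i x
    simp only [iteratedDeriv_zero, pow_zero, mul_one] at h2
    rw [add_sub_cancel_left] at h1
    refine h1.trans ?_
    rw [mul_assoc, ← sq_abs (σ i x)]
    gcongr
    calc |σ i x| ^ 2 ≤ (D * w i x) ^ 2 := by gcongr
      _ = _ := by ring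
  · have := (((hσ (n + 1)).deriv).mul (rpow_sub hl hρ₀ hσ1 hσ h n (a - 1))).smul a
    convert this using 1
    · funext i x
      rw [(((hasDerivAt_add_rpow a (hd i x) (hl.trans_le (h i x).1)).sub_const _).sub
        ((hd i x).hasDerivAt.const_mul _)).deriv]
      ring
    · funext i x
      ring

end Power

section ErrorFunction

lemma integral_exp_neg_sq_neg (z : ℝ) :
    ∫ η in (0:ℝ)..(-z), Real.exp (-η ^ 2) = -∫ η in (0:ℝ)..z, Real.exp (-η ^ 2) := by
  have := intervalIntegral.integral_comp_neg (a := 0) (b := z)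
    (fun η : ℝ => Real.exp (-η ^ 2))
  simp only [neg_sq, neg_zero] at this
  rw [this, intervalIntegral.integral_symm]

lemma tendsto_integral_exp_neg_sq :
    Tendsto (fun z : ℝ => ∫ η in (0:ℝ)..z, Real.exp (-η ^ 2)) atTop (𝓝 (Real.sqrt Real.pi / 2)) := by
  have h := intervalIntegral_tendsto_integral_Ioi (f := fun η : ℝ => Real.exp (-1 * η ^ 2)) 0
    (integrable_exp_neg_mul_sq one_pos).integrableOn tendsto_id
  rw [integral_gaussian_Ioi] at h
  simpa using h

lemma monotone_integral_exp_neg_sq :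
    Monotone (fun z : ℝ => ∫ η in (0:ℝ)..z, Real.exp (-η ^ 2)) := by
  have hc : Continuous fun η : ℝ => Real.exp (-η ^ 2) := by fun_prop
  refine monotone_of_deriv_nonneg (fun z =>
    (hc.integral_hasStrictDerivAt 0 z).hasDerivAt.differentiableAt) fun z => ?_
  rw [hc.deriv_integral]
  positivity

lemma integral_exp_neg_sq_le (z : ℝ) :
    ∫ η in (0:ℝ)..z, Real.exp (-η ^ 2) ≤ Real.sqrt Real.pi / 2 :=
  monotone_integral_exp_neg_sq.ge_of_tendsto tendsto_integral_exp_neg_sq z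

lemma sub_integral_exp_neg_sq_le {z : ℝ} (hz : 0 ≤ z) :
    Real.sqrt Real.pi / 2 - ∫ η in (0:ℝ)..z, Real.exp (-η ^ 2) ≤
      Real.sqrt Real.pi / 2 * Real.exp (-z ^ 2) := by
  have hc : Continuous fun η : ℝ => Real.exp (-η ^ 2) := by fun_prop
  refine le_of_tendsto (tendsto_integral_exp_neg_sq.sub_const _) ?_
  filter_upwards [eventually_ge_atTop z] with b hb
  rw [intervalIntegral.integral_interval_sub_left (hc.intervalIntegrable _ _)
    (hc.intervalIntegrable _ _)]
  have h1 : ∫ η in z..b, Real.exp (-η ^ 2) = ∫ u in (0:ℝ)..(b - z), Real.exp (-(u + z) ^ 2) := by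
    rw [intervalIntegral.integral_comp_add_right (fun η : ℝ => Real.exp (-η ^ 2))]
    simp
  rw [h1]
  calc ∫ u in (0:ℝ)..(b - z), Real.exp (-(u + z) ^ 2)
      ≤ ∫ u in (0:ℝ)..(b - z), Real.exp (-u ^ 2) * Real.exp (-z ^ 2) := by
        refine intervalIntegral.integral_mono_on (by linarith)
          (Continuous.intervalIntegrable (by fun_prop) _ _)
          (Continuous.intervalIntegrable (by fun_prop) _ _) fun u hu => ?_
        rw [← Real.exp_add, Real.exp_le_exp]
        nlinarith [mul_nonneg hu.1 hz]
    _ ≤ _ := by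
        rw [intervalIntegral.integral_mul_const]
        gcongr
        exact integral_exp_neg_sq_le _

lemma Theta_neg (ρb μ ξ : ℝ) : Theta ρb μ (-ξ) = -Theta ρb μ ξ := by
  rw [Theta, Theta, mul_neg, integral_exp_neg_sq_neg, mul_neg]

lemma Theta_le_one (ρb μ ξ : ℝ) : Theta ρb μ ξ ≤ 1 := by
  have hπ : 0 < Real.sqrt Real.pi := Real.sqrt_pos.2 Real.pi_pos
  rw [Theta]
  calc _ ≤ 2 / Real.sqrt Real.pi * (Real.sqrt Real.pi / 2) := by
        gcongr
        exact integral_exp_neg_sq_le _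
    _ = 1 := by field_simp

lemma abs_Theta_le_one (ρb μ ξ : ℝ) : |Theta ρb μ ξ| ≤ 1 := by
  have h := Theta_le_one ρb μ (-ξ)
  rw [Theta_neg] at h
  exact abs_le.2 ⟨by linarith, Theta_le_one ρb μ ξ⟩

lemma one_sub_Theta_le {ρb μ ξ : ℝ} (h : 0 ≤ ρb / μ) (hξ : 0 ≤ ξ) :
    1 - Theta ρb μ ξ ≤ Real.exp (-(ρb / (4 * μ)) * ξ ^ 2) := by
  have hπ : 0 < Real.sqrt Real.pi := Real.sqrt_pos.2 Real.pi_pos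
  have h1 := sub_integral_exp_neg_sq_le (z := (1/2) * Real.sqrt (ρb/μ) * ξ) (by positivity)
  rw [mul_pow, mul_pow, Real.sq_sqrt h] at h1
  have h2 : 2 / Real.sqrt Real.pi * (Real.sqrt Real.pi / 2) = 1 := by field_simp
  calc 1 - Theta ρb μ ξ = 2 / Real.sqrt Real.pi * (Real.sqrt Real.pi / 2 -
        ∫ η in (0:ℝ)..((1/2) * Real.sqrt (ρb/μ) * ξ), Real.exp (-η^2)) := by
        rw [mul_sub, h2, Theta]
    _ ≤ 2 / Real.sqrt Real.pi *
        (Real.sqrt Real.pi / 2 * Real.exp (-((1 / 2) ^ 2 * (ρb / μ) * ξ ^ 2))) := by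
        gcongr
    _ = _ := by
        rw [← mul_assoc, h2, one_mul]
        congr 1
        ring

lemma one_sub_Theta_le_max {ρb μ : ℝ} (h : 0 ≤ ρb / μ) (ξ : ℝ) :
    1 - Theta ρb μ ξ ≤ 2 * Real.exp (-(ρb / (4 * μ)) * max ξ 0 ^ 2) := by
  rcases le_total 0 ξ with hξ | hξ
  · rw [max_eq_left hξ]
    linarith [one_sub_Theta_le h hξ, Real.exp_pos (-(ρb / (4 * μ)) * ξ ^ 2)]
  · rw [max_eq_right hξ]
    have := (abs_le.1 (abs_Theta_le_one ρb μ ξ)).1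
    norm_num
    linarith

lemma hasDerivAt_Theta {ρb μ : ℝ} (h : 0 ≤ ρb / μ) (ξ : ℝ) : HasDerivAt (Theta ρb μ)
    (2 / Real.sqrt Real.pi * ((1/2) * Real.sqrt (ρb/μ)) * Real.exp (-(ρb / (4 * μ)) * ξ ^ 2)) ξ := by
  have hc : Continuous fun η : ℝ => Real.exp (-η ^ 2) := by fun_prop
  have h1 := (hc.integral_hasStrictDerivAt 0 ((1/2) * Real.sqrt (ρb/μ) * ξ)).hasDerivAt
  have h2 := ((h1.comp ξ ((hasDerivAt_id' ξ).const_mul ((1/2) * Real.sqrt (ρb/μ)))).const_mul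
    (2 / Real.sqrt Real.pi))
  refine HasDerivAt.congr_deriv h2 ?_
  rw [mul_pow, mul_pow, Real.sq_sqrt h]
  have : -((1 / 2) ^ 2 * (ρb / μ) * ξ ^ 2) = -(ρb / (4 * μ)) * ξ ^ 2 := by ring
  rw [this]
  ring

end ErrorFunction

section Waves

variable {ι : Type*} {Λ : ℝ} {t : ι → ℝ}

lemma scaledBound_vtheta (hΛ : ∀ i, 0 < t i + Λ) (n : ℕ) (a : ι → ℝ) :
    ScaledBound (fun i => Real.sqrt (t i + Λ)) n (fun i x => vtheta Λ (x - a i) (t i))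
      (fun i x => (Real.sqrt (t i + Λ))⁻¹ * Real.exp (-(1 / 8) * (x - a i) ^ 2 / (t i + Λ))) := by
  have h := ScaledBound.gaussian (s := fun i => Real.sqrt (t i + Λ))
    (fun i => Real.sqrt_pos.2 (hΛ i)) n (κ := 1 / 4) (by norm_num) a
  have h2 := (h.const_mul (fun i => (Real.sqrt (t i + Λ))⁻¹)).smul (1 / (2 * Real.sqrt Real.pi))
  convert h2 using 1
  · funext i x
    rw [vtheta, Real.sqrt_mul Real.pi_pos.le, Real.sq_sqrt (hΛ i).le, ← mul_assoc]
    have : -(x - a i) ^ 2 / (4 * (t i + Λ)) = -(1 / 4) * (x - a i) ^ 2 / (t i + Λ) := by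
      have := (hΛ i).ne'
      field_simp
    rw [this]
    ring
  · funext i x
    rw [Real.sq_sqrt (hΛ i).le, abs_of_nonneg (by positivity)]
    norm_num

lemma hasDerivAt_theta {ρb μ t x : ℝ} (h : 0 ≤ ρb / μ) (hΛ : 0 < t + Λ) :
    HasDerivAt (fun y => theta ρb μ Λ y t)
      (2 / Real.sqrt Real.pi * ((1/2) * Real.sqrt (ρb/μ)) *
        ((Real.sqrt (t + Λ))⁻¹ * Real.exp (-(ρb / (4 * μ)) * x ^ 2 / (t + Λ)))) x := by
  have h1 := (hasDerivAt_Theta h (x / Real.sqrt (t + Λ))).comp x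
    ((hasDerivAt_id' x).div_const (Real.sqrt (t + Λ)))
  refine HasDerivAt.congr_deriv h1 ?_
  rw [div_pow, Real.sq_sqrt hΛ.le, mul_div_assoc]
  ring

lemma scaledBound_theta_affine {ρb μ : ℝ} (h : 0 < ρb / μ) (hΛ : ∀ i, 0 < t i + Λ) (n : ℕ)
    (c d : ℝ) {w : ι → ℝ → ℝ} {C : ℝ} (hC : 0 ≤ C)
    (hw : ∀ i x, |c + d * theta ρb μ Λ x (t i)| ≤ C * w i x)
    (hw' : ∀ i x, Real.exp (-(ρb / (8 * μ)) * x ^ 2 / (t i + Λ)) ≤ w i x) :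
    ScaledBound (fun i => Real.sqrt (t i + Λ)) n (fun i x => c + d * theta ρb μ Λ x (t i)) w := by
  have hs : ∀ i, 0 < Real.sqrt (t i + Λ) := fun i => Real.sqrt_pos.2 (hΛ i)
  have hd := fun i x => ((hasDerivAt_theta (x := x) h.le (hΛ i)).const_mul d).const_add c
  refine (ScaledBound.succ_of_deriv C hC (fun i x => (hd i x).differentiableAt) hw ?_).of_le
    n.le_succ
  have h1 := ScaledBound.gaussian hs n (κ := ρb / (4 * μ)) (by
    rw [mul_comm, ← div_div]
    positivity) (fun _ => 0)
  have h2 := ((h1.const_mul (fun i => (Real.sqrt (t i + Λ))⁻¹)).smul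
    (2 / Real.sqrt Real.pi * ((1/2) * Real.sqrt (ρb/μ)))).smul d
  simp only [sub_zero, Real.sq_sqrt (hΛ _).le] at h2
  have hderiv : (fun i => deriv (fun x => c + d * theta ρb μ Λ x (t i))) = fun i x =>
      d * (2 / Real.sqrt Real.pi * ((1/2) * Real.sqrt (ρb/μ)) * ((Real.sqrt (t i + Λ))⁻¹ *
        Real.exp (-(ρb / (4 * μ)) * x ^ 2 / (t i + Λ)))) := by
    funext i x
    exact (hd i x).deriv
  rw [hderiv]
  refine h2.mono hs 1 zero_le_one fun i x => ?_
  rw [one_mul, abs_of_nonneg (inv_nonneg.2 (hs i).le)]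
  gcongr
  refine le_trans (le_of_eq ?_) (hw' i x)
  congr 2
  ring

lemma shifted_gaussian_mul_half_gaussian_le {b v τ y : ℝ} (hb : 0 < b) (hv : 0 < v)
    (hτ : 1 ≤ τ) :
    Real.exp (-b * (y - v * τ) ^ 2 / τ) * Real.exp (-b * max y 0 ^ 2 / τ) ≤
      4 / (b * v ^ 2) * ((Real.sqrt τ)⁻¹ * Real.exp (-(b / 2) * (y - v * τ) ^ 2 / τ)) := by
  have hτ0 : 0 < τ := by linarith
  have hvτ : 0 < v * τ := by positivity
  have h1 : v ^ 2 * τ ^ 2 / 4 ≤ (y - v * τ) ^ 2 / 2 + max y 0 ^ 2 := by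
    rcases le_total 0 y with hy | hy
    · rw [max_eq_left hy]
      nlinarith [sq_nonneg (3 * y - v * τ)]
    · rw [max_eq_right hy]
      nlinarith [mul_nonneg (neg_nonneg.2 hy) hvτ.le, sq_nonneg y, sq_nonneg (v * τ)]
  have h2 : Real.exp (-(b * v ^ 2 / 4 * τ)) ≤ 4 / (b * v ^ 2) * (Real.sqrt τ)⁻¹ := by
    have hA : 0 < b * v ^ 2 / 4 * τ := by positivity
    have h3 : Real.exp (-(b * v ^ 2 / 4 * τ)) ≤ (b * v ^ 2 / 4 * τ)⁻¹ := by
      rw [Real.exp_neg]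
      gcongr
      linarith [Real.add_one_le_exp (b * v ^ 2 / 4 * τ)]
    refine h3.trans ?_
    have h4 : Real.sqrt τ ≤ τ := Real.sqrt_le_iff.2 ⟨hτ0.le, by nlinarith⟩
    have h5 : 0 < Real.sqrt τ := Real.sqrt_pos.2 hτ0
    calc (b * v ^ 2 / 4 * τ)⁻¹ = 4 / (b * v ^ 2) * τ⁻¹ := by field_simp
      _ ≤ _ := by gcongr
  calc Real.exp (-b * (y - v * τ) ^ 2 / τ) * Real.exp (-b * max y 0 ^ 2 / τ)
      ≤ Real.exp (-(b * v ^ 2 / 4 * τ)) * Real.exp (-(b / 2) * (y - v * τ) ^ 2 / τ) := by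
        rw [← Real.exp_add, ← Real.exp_add, Real.exp_le_exp, ← add_div, div_le_iff₀ hτ0, add_mul,
          div_mul_cancel₀ _ hτ0.ne']
        nlinarith
    _ ≤ _ := by
        rw [← mul_assoc]
        gcongr

end Waves

/-- Amplitudes bounded by `ε ≤ ε₀`, together with a nonnegative time. -/
structure WaveParam (ε₀ : ℝ) where
  ε : ℝ
  α₀ : ℝ
  α : ℝ
  α₃ : ℝ
  t : ℝ
  abs_α₀_le : |α₀| ≤ ε
  abs_α_le : |α| ≤ ε
  abs_α₃_le : |α₃| ≤ ε
  ε_le : ε ≤ ε₀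
  t_nonneg : 0 ≤ t

namespace WaveParam

variable {ε₀ ρb μ lam γ Λ b : ℝ}

lemma ε_nonneg (p : WaveParam ε₀) : 0 ≤ p.ε := (abs_nonneg _).trans p.abs_α₀_le

lemma one_le_time (hΛ : 1 ≤ Λ) (p : WaveParam ε₀) : 1 ≤ p.t + Λ := by linarith [p.t_nonneg]

lemma time_pos (hΛ : 1 ≤ Λ) (p : WaveParam ε₀) : 0 < p.t + Λ := by linarith [p.t_nonneg]

/-- The diffusive length scale `√(t + Λ)`. -/
noncomputable def scale (Λ : ℝ) (p : WaveParam ε₀) : ℝ := Real.sqrt (p.t + Λ)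

lemma scale_pos (hΛ : 1 ≤ Λ) (p : WaveParam ε₀) : 0 < p.scale Λ :=
  Real.sqrt_pos.2 (p.time_pos hΛ)

lemma scale_inv_le_one (hΛ : 1 ≤ Λ) (p : WaveParam ε₀) : (p.scale Λ)⁻¹ ≤ 1 :=
  inv_le_one_of_one_le₀ (Real.one_le_sqrt.2 (p.one_le_time hΛ))

/-- The size `ε (t + Λ)^{-1/2} 𝔈` of the diffusion waves. -/
noncomputable def weight (ρb γ Λ c₀ : ℝ) (p : WaveParam ε₀) (x : ℝ) : ℝ :=
  p.ε * ((p.scale Λ)⁻¹ * envE ρb γ Λ c₀ x p.t)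

lemma envE_nonneg (c₀ x t : ℝ) : 0 ≤ envE ρb γ Λ c₀ x t := by
  unfold envE
  positivity

lemma envE_le_three {c₀ : ℝ} (hc : 0 ≤ c₀) (x : ℝ) {t : ℝ} (ht : 0 < t + Λ) :
    envE ρb γ Λ c₀ x t ≤ 3 := by
  have h : ∀ y : ℝ, Real.exp (-c₀ * y ^ 2 / (t + Λ)) ≤ 1 := fun y => by
    rw [Real.exp_le_one_iff, neg_mul, neg_div]
    exact neg_nonpos.2 (by positivity)
  unfold envE
  linarith [h x, h (x - lam0 ρb γ * (t + Λ)), h (x - lam3 ρb γ * (t + Λ))]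

lemma center_le_envE (c₀ x t : ℝ) : Real.exp (-c₀ * x ^ 2 / (t + Λ)) ≤ envE ρb γ Λ c₀ x t := by
  unfold envE
  linarith [Real.exp_pos (-c₀ * (x - lam0 ρb γ * (t + Λ)) ^ 2 / (t + Λ)),
    Real.exp_pos (-c₀ * (x - lam3 ρb γ * (t + Λ)) ^ 2 / (t + Λ))]

lemma left_le_envE (c₀ x t : ℝ) :
    Real.exp (-c₀ * (x - lam0 ρb γ * (t + Λ)) ^ 2 / (t + Λ)) ≤ envE ρb γ Λ c₀ x t := by
  unfold envE
  linarith [Real.exp_pos (-c₀ * x ^ 2 / (t + Λ)),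
    Real.exp_pos (-c₀ * (x - lam3 ρb γ * (t + Λ)) ^ 2 / (t + Λ))]

lemma right_le_envE (c₀ x t : ℝ) :
    Real.exp (-c₀ * (x - lam3 ρb γ * (t + Λ)) ^ 2 / (t + Λ)) ≤ envE ρb γ Λ c₀ x t := by
  unfold envE
  linarith [Real.exp_pos (-c₀ * (x - lam0 ρb γ * (t + Λ)) ^ 2 / (t + Λ)),
    Real.exp_pos (-c₀ * x ^ 2 / (t + Λ))]

lemma weight_nonneg (hΛ : 1 ≤ Λ) (c₀ : ℝ) (p : WaveParam ε₀) (x : ℝ) :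
    0 ≤ p.weight ρb γ Λ c₀ x :=
  mul_nonneg p.ε_nonneg (mul_nonneg (inv_nonneg.2 (p.scale_pos hΛ).le) (envE_nonneg _ _ _))

lemma weight_le_scale (hΛ : 1 ≤ Λ) {c₀ : ℝ} (hc : 0 ≤ c₀) (p : WaveParam ε₀) (x : ℝ) :
    p.weight ρb γ Λ c₀ x ≤ 3 * ε₀ * (p.scale Λ)⁻¹ := by
  have hs := inv_pos.2 (p.scale_pos hΛ)
  calc p.weight ρb γ Λ c₀ x ≤ ε₀ * ((p.scale Λ)⁻¹ * 3) := by
        have h0 := p.ε_nonneg.trans p.ε_le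
        have h1 := envE_nonneg (ρb := ρb) (γ := γ) (Λ := Λ) c₀ x p.t
        unfold weight
        gcongr
        · exact p.ε_le
        · exact envE_le_three hc x (p.time_pos hΛ)
    _ = _ := by ring

lemma weight_le_const (hΛ : 1 ≤ Λ) {c₀ : ℝ} (hc : 0 ≤ c₀) (p : WaveParam ε₀) (x : ℝ) :
    p.weight ρb γ Λ c₀ x ≤ 3 * ε₀ * 1 := by
  have h0 := p.ε_nonneg.trans p.ε_le
  refine (weight_le_scale hΛ hc p x).trans ?_
  gcongr
  exact p.scale_inv_le_one hΛ

lemma weight_mul_weight_le (hΛ : 1 ≤ Λ) {c₀ : ℝ} (hc : 0 ≤ c₀) (p : WaveParam ε₀) (x : ℝ) :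
    p.weight ρb γ Λ c₀ x * p.weight ρb γ Λ c₀ x ≤
      3 * ε₀ * ((p.scale Λ)⁻¹ * p.weight ρb γ Λ c₀ x) := by
  rw [← mul_assoc]
  exact mul_le_mul_of_nonneg_right (weight_le_scale hΛ hc p x) (weight_nonneg hΛ c₀ p x)

lemma scaledBound_wave (hΛ : 1 ≤ Λ) (hb : b ≤ 1 / 8) (n : ℕ)
    {A a : WaveParam ε₀ → ℝ} (hA : ∀ p, |A p| ≤ p.ε)
    (ha : ∀ p x, Real.exp (-(b / 2) * (x - a p) ^ 2 / (p.t + Λ)) ≤ envE ρb γ Λ (b / 2) x p.t) :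
    ScaledBound (scale Λ) n (fun p x => A p * vtheta Λ (x - a p) p.t)
      (weight ρb γ Λ (b / 2)) := by
  refine ((scaledBound_vtheta (time_pos hΛ) n a).const_mul A).mono (scale_pos hΛ) 1 zero_le_one
    fun p x => ?_
  have hs := inv_pos.2 (p.scale_pos hΛ)
  have hτ := p.time_pos hΛ
  have := p.ε_nonneg
  rw [one_mul, weight]
  refine mul_le_mul (hA p) (mul_le_mul_of_nonneg_left (le_trans ?_ (ha p x)) hs.le)
    (mul_nonneg hs.le (Real.exp_pos _).le) this
  refine Real.exp_le_exp.2 (div_le_div_of_nonneg_right ?_ hτ.le)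
  nlinarith [sq_nonneg (x - a p)]

lemma scaledBound_left (hΛ : 1 ≤ Λ) (hb : b ≤ 1 / 8) (n : ℕ) :
    ScaledBound (ι := WaveParam ε₀) (scale Λ) n (fun p x => p.α₀ * vthm ρb γ Λ x p.t)
      (weight ρb γ Λ (b / 2)) :=
  scaledBound_wave hΛ hb n abs_α₀_le fun p x => left_le_envE _ x p.t

lemma scaledBound_right (hΛ : 1 ≤ Λ) (hb : b ≤ 1 / 8) (n : ℕ) :
    ScaledBound (ι := WaveParam ε₀) (scale Λ) n (fun p x => p.α₃ * vthp ρb γ Λ x p.t)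
      (weight ρb γ Λ (b / 2)) :=
  scaledBound_wave hΛ hb n abs_α₃_le fun p x => right_le_envE _ x p.t

lemma scaledBound_center (hΛ : 1 ≤ Λ) (hb : b ≤ 1 / 8) (n : ℕ) :
    ScaledBound (ι := WaveParam ε₀) (scale Λ) n (fun p x => p.α * vtheta Λ x p.t)
      (weight ρb γ Λ (b / 2)) := by
  have := scaledBound_wave (ρb := ρb) (γ := γ) hΛ hb n (abs_α_le (ε₀ := ε₀)) (a := fun _ => 0)
    fun p x => by simpa using center_le_envE (b / 2) x p.t
  simpa using this

/-- Away from the transition layer of `θ`, where it is exponentially close to its limit `±1`, the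
product of `1 ∓ θ` with a diffusion wave travelling in the direction `±1` is negligible. -/
lemma scaledBound_one_sub_theta_mul_wave (hΛ : 1 ≤ Λ) (hb : b ≤ 1 / 8) (hb0 : 0 < b)
    (h : 0 < ρb / μ) (hbμ : b ≤ ρb / (8 * μ)) (n : ℕ) {A : WaveParam ε₀ → ℝ}
    (hA : ∀ p, |A p| ≤ p.ε) {d v : ℝ} (hd : d = 1 ∨ d = -1) (hv : 0 < v)
    (ha : ∀ p : WaveParam ε₀, ∀ x,
      Real.exp (-(b / 2) * (x - d * v * (p.t + Λ)) ^ 2 / (p.t + Λ)) ≤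
        envE ρb γ Λ (b / 2) x p.t) :
    ScaledBound (scale Λ) n
      (fun p x => A p * vtheta Λ (x - d * v * (p.t + Λ)) p.t * (1 - d * theta ρb μ Λ x p.t))
      (fun p x => (p.scale Λ)⁻¹ * weight ρb γ Λ (b / 2) p x) := by
  have hd2 : d ^ 2 = 1 := by rcases hd with rfl | rfl <;> norm_num
  have h1 := scaledBound_theta_affine (ι := WaveParam ε₀) (w := fun p x =>
    Real.exp (-b * max (d * x) 0 ^ 2 / (p.t + Λ))) h (time_pos hΛ) n 1 (-d) zero_le_two
    (fun p x => ?_) (fun p x => ?_)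
  · have h2 := ((scaledBound_vtheta (time_pos hΛ) n
      (fun p : WaveParam ε₀ => d * v * (p.t + Λ))).const_mul A).mul h1
    simp only [neg_mul, ← sub_eq_add_neg] at h2
    refine h2.mono (scale_pos hΛ) (4 / (b * v ^ 2)) (by positivity) fun p x => ?_
    have hs := inv_pos.2 (p.scale_pos hΛ)
    have hτ := p.time_pos hΛ
    have hε := p.ε_nonneg
    have h3 := shifted_gaussian_mul_half_gaussian_le (y := d * x) hb0 hv (p.one_le_time hΛ)
    have h4 : (d * x - v * (p.t + Λ)) ^ 2 = (x - d * v * (p.t + Λ)) ^ 2 := by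
      linear_combination (x ^ 2 - v ^ 2 * (p.t + Λ) ^ 2) * hd2
    rw [h4] at h3
    simp only [neg_mul] at h3
    calc |A p| * ((Real.sqrt (p.t + Λ))⁻¹ *
          Real.exp (-(1 / 8 * (x - d * v * (p.t + Λ)) ^ 2) / (p.t + Λ))) *
          Real.exp (-(b * max (d * x) 0 ^ 2) / (p.t + Λ))
        ≤ p.ε * ((p.scale Λ)⁻¹ * Real.exp (-(b * (x - d * v * (p.t + Λ)) ^ 2) / (p.t + Λ))) *
          Real.exp (-(b * max (d * x) 0 ^ 2) / (p.t + Λ)) := by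
          unfold scale at hs ⊢
          gcongr
          exact hA p
      _ = p.ε * (p.scale Λ)⁻¹ * (Real.exp (-(b * (x - d * v * (p.t + Λ)) ^ 2) / (p.t + Λ)) *
          Real.exp (-(b * max (d * x) 0 ^ 2) / (p.t + Λ))) := by ring
      _ ≤ p.ε * (p.scale Λ)⁻¹ * (4 / (b * v ^ 2) * ((p.scale Λ)⁻¹ *
          Real.exp (-(b / 2 * (x - d * v * (p.t + Λ)) ^ 2) / (p.t + Λ)))) := by
          exact mul_le_mul_of_nonneg_left h3 (by positivity)
      _ ≤ p.ε * (p.scale Λ)⁻¹ * (4 / (b * v ^ 2) * ((p.scale Λ)⁻¹ *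
          envE ρb γ Λ (b / 2) x p.t)) := by
          have := ha p x
          rw [neg_mul] at this
          gcongr
      _ = _ := by
          rw [weight]
          ring
  · have hτ := p.time_pos hΛ
    have hθ : d * theta ρb μ Λ x p.t = Theta ρb μ (d * x / Real.sqrt (p.t + Λ)) := by
      rcases hd with rfl | rfl
      · simp [theta]
      · rw [neg_one_mul, neg_one_mul, neg_div, Theta_neg, theta]
    rw [neg_mul, hθ, ← sub_eq_add_neg,
      abs_of_nonneg (by linarith [Theta_le_one ρb μ (d * x / Real.sqrt (p.t + Λ))])]
    refine (one_sub_Theta_le_max h.le _).trans ?_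
    have hm : max (d * x / Real.sqrt (p.t + Λ)) 0 ^ 2 = max (d * x) 0 ^ 2 / (p.t + Λ) := by
      conv_rhs => rw [← Real.sq_sqrt hτ.le, ← div_pow]
      rw [← max_div_div_right (Real.sqrt_nonneg _), zero_div]
    rw [hm, ← mul_div_assoc]
    gcongr
    calc b ≤ ρb / (8 * μ) := hbμ
      _ = ρb / μ * (1 / 8) := by ring
      _ ≤ ρb / μ * (1 / 4) := by gcongr; norm_num
      _ = _ := by ring
  · have hτ := p.time_pos hΛ
    have hm : max (d * x) 0 ^ 2 ≤ x ^ 2 := by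
      rw [show x ^ 2 = (d * x) ^ 2 by rw [mul_pow, hd2, one_mul]]
      rcases le_total 0 (d * x) with hx | hx
      · rw [max_eq_left hx]
      · rw [max_eq_right hx, zero_pow two_ne_zero]
        positivity
    refine Real.exp_le_exp.2 (div_le_div_of_nonneg_right ?_ hτ.le)
    rw [neg_mul, neg_mul, neg_le_neg_iff]
    have := hb0.le.trans hbμ
    gcongr

lemma scaledBound_perturbation (hΛ : 1 ≤ Λ) (hb : b ≤ 1 / 8) (n : ℕ) :
    ScaledBound (ι := WaveParam ε₀) (scale Λ) n
      (fun p x => p.α₀ * vthm ρb γ Λ x p.t + p.α₃ * vthp ρb γ Λ x p.t)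
      (weight ρb γ Λ (b / 2)) :=
  (scaledBound_left hΛ hb n).add (scaledBound_right hΛ hb n)

lemma scaledBound_perturbation_one (hε₀ : 0 ≤ ε₀) (hΛ : 1 ≤ Λ) (hb : b ≤ 1 / 8) (hb0 : 0 < b)
    (n : ℕ) : ScaledBound (ι := WaveParam ε₀) (scale Λ) n
      (fun p x => p.α₀ * vthm ρb γ Λ x p.t + p.α₃ * vthp ρb γ Λ x p.t) (fun _ _ => 1) :=
  (scaledBound_perturbation hΛ hb n).mono (scale_pos hΛ) (3 * ε₀) (by positivity)
    (weight_le_const hΛ (by positivity))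

lemma abs_vtheta_le_one {x t : ℝ} (h : 1 ≤ t + Λ) : |vtheta Λ x t| ≤ 1 := by
  have hτ : 0 < t + Λ := by linarith
  have h1 : 1 ≤ 2 * Real.sqrt (Real.pi * (t + Λ)) := by
    have : 1 ≤ Real.sqrt (Real.pi * (t + Λ)) := Real.one_le_sqrt.2 (by
      nlinarith [Real.pi_gt_three])
    linarith
  rw [vtheta, abs_of_nonneg (by positivity)]
  refine mul_le_one₀ ?_ (Real.exp_pos _).le ?_
  · rw [one_div]
    exact inv_le_one_of_one_le₀ h1
  · rw [Real.exp_le_one_iff, neg_div]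
    exact neg_nonpos.2 (by positivity)

lemma density_mem_Icc (hΛ : 1 ≤ Λ) (hρ : ε₀ = ρb / 4) (p : WaveParam ε₀) (x : ℝ) :
    ρb + (p.α₀ * vthm ρb γ Λ x p.t + p.α₃ * vthp ρb γ Λ x p.t) ∈
      Set.Icc (ρb / 2) (2 * ρb) := by
  have h : ∀ α y, |α| ≤ p.ε → |α * vtheta Λ y p.t| ≤ ρb / 4 := fun α y hα => by
    rw [abs_mul]
    have h1 := abs_vtheta_le_one (Λ := Λ) (x := y) (p.one_le_time hΛ)
    calc |α| * |vtheta Λ y p.t| ≤ |α| * 1 := by gcongr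
      _ ≤ _ := by linarith [p.ε_le]
  have h1 := abs_le.1 (h p.α₀ (x - lam0 ρb γ * (p.t + Λ)) p.abs_α₀_le)
  have h2 := abs_le.1 (h p.α₃ (x - lam3 ρb γ * (p.t + Λ)) p.abs_α₃_le)
  have := p.ε_nonneg.trans p.ε_le
  unfold vthm vthp
  constructor <;> linarith [h1.1, h1.2, h2.1, h2.2]

lemma rhoT_eq (p : WaveParam ε₀) (x : ℝ) : rhoT ρb γ Λ p.α₀ p.α₃ x p.t =
    ρb + (p.α₀ * vthm ρb γ Λ x p.t + p.α₃ * vthp ρb γ Λ x p.t) := by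
  rw [rhoT, add_assoc]

lemma rhoT_pos (hρb : 0 < ρb) (hΛ : 1 ≤ Λ) (hρ : ε₀ = ρb / 4) (p : WaveParam ε₀) (x : ℝ) :
    0 < rhoT ρb γ Λ p.α₀ p.α₃ x p.t := by
  rw [rhoT_eq]
  linarith [(density_mem_Icc (γ := γ) hΛ hρ p x).1]

lemma scaledBound_inv_rhoT (hρb : 0 < ρb) (hΛ : 1 ≤ Λ) (hb : b ≤ 1 / 8) (hb0 : 0 < b)
    (hρ : ε₀ = ρb / 4) (n : ℕ) :
    ScaledBound (ι := WaveParam ε₀) (scale Λ) n (fun p x => (rhoT ρb γ Λ p.α₀ p.α₃ x p.t)⁻¹)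
      (fun _ _ => 1) := by
  have hε₀ : 0 ≤ ε₀ := by rw [hρ]; positivity
  have h := ScaledBound.rpow (half_pos hρb)
    (scaledBound_perturbation_one (ρb := ρb) (γ := γ) hε₀ hΛ hb hb0)
    (density_mem_Icc hΛ hρ) n (-1)
  simpa only [Real.rpow_neg_one, ← rhoT_eq] using h

lemma scaledBound_m3T (hΛ : 1 ≤ Λ) (hb : b ≤ 1 / 8) (n : ℕ) :
    ScaledBound (ι := WaveParam ε₀) (scale Λ) n (fun p x => m3T ρb γ Λ p.α₀ p.α₃ x p.t)
      (weight ρb γ Λ (b / 2)) := by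
  simpa only [m3T, mul_assoc] using ((scaledBound_left hΛ hb n).smul (lam0 ρb γ)).add
    ((scaledBound_right hΛ hb n).smul (lam3 ρb γ))

/-- The deviation `ũᵢ - ūᵢ θ` of the transverse velocity, with the cancellation of the leading term
carried out. -/
noncomputable def velocityDeviation (ρb μ γ Λ u : ℝ) (p : WaveParam ε₀) (x : ℝ) : ℝ :=
  (u * (p.α₃ * vthp ρb γ Λ x p.t + -1 * (p.α₀ * vthm ρb γ Λ x p.t)) + p.α * vtheta Λ x p.t
    + -u * (theta ρb μ Λ x p.t * (p.α₀ * vthm ρb γ Λ x p.t + p.α₃ * vthp ρb γ Λ x p.t)))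
    * (rhoT ρb γ Λ p.α₀ p.α₃ x p.t)⁻¹

lemma miT_div_rhoT (hρb : 0 < ρb) (hΛ : 1 ≤ Λ) (hρ : ε₀ = ρb / 4) (u : ℝ) (p : WaveParam ε₀)
    (x : ℝ) : miT ρb μ γ Λ u p.α p.α₀ p.α₃ x p.t / rhoT ρb γ Λ p.α₀ p.α₃ x p.t =
      theta ρb μ Λ x p.t * u + p.velocityDeviation ρb μ γ Λ u x := by
  have h := (rhoT_pos (γ := γ) hρb hΛ hρ p x).ne'
  rw [velocityDeviation, ← div_eq_mul_inv, div_eq_iff h, add_mul, div_mul_cancel₀ _ h, miT, rhoT]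
  ring

lemma scaledBound_velocityDeviation (hρb : 0 < ρb) (hμ : 0 < μ) (hΛ : 1 ≤ Λ) (hb : b ≤ 1 / 8)
    (hb0 : 0 < b) (hρ : ε₀ = ρb / 4) (n : ℕ) (u : ℝ) :
    ScaledBound (ι := WaveParam ε₀) (scale Λ) n (velocityDeviation ρb μ γ Λ u)
      (weight ρb γ Λ (b / 2)) := by
  have hθ : ScaledBound (ι := WaveParam ε₀) (scale Λ) n (fun p x => theta ρb μ Λ x p.t)
      (fun _ _ => 1) := by
    have := scaledBound_theta_affine (ι := WaveParam ε₀) (w := fun _ _ => 1) (div_pos hρb hμ)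
      (time_pos hΛ) n 0 1 zero_le_one (fun p x => ?_) fun p x => ?_
    · simp only [zero_add, one_mul] at this
      exact this
    · simpa [theta] using abs_Theta_le_one ρb μ _
    · have := p.time_pos hΛ
      rw [Real.exp_le_one_iff, neg_mul, neg_div]
      exact neg_nonpos.2 (by positivity)
  have h1 := ((scaledBound_right (ε₀ := ε₀) (ρb := ρb) (γ := γ) hΛ hb n).add
    ((scaledBound_left hΛ hb n).smul (-1))).smul u
  have h2 := h1.add (scaledBound_center hΛ hb n)
  have h3 := (hθ.mul (scaledBound_perturbation (ρb := ρb) (γ := γ) hΛ hb n)).smul (-u)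
  simp only [one_mul] at h3
  have h4 := (h2.add h3).mul (scaledBound_inv_rhoT (γ := γ) hρb hΛ hb hb0 hρ n)
  simp only [mul_one] at h4
  exact h4

lemma lam3_pos (hρb : 0 < ρb) (hγ : 1 < γ) : 0 < lam3 ρb γ :=
  Real.sqrt_pos.2 (by positivity)

/-- The transverse convection error: the leading term `ūᵢ θ m̃₃` cancels up to the exponentially
small interaction of `1 ∓ θ` with the diffusion waves. -/
lemma scaledBound_convection (hρb : 0 < ρb) (hμ : 0 < μ) (hγ : 1 < γ) (hΛ : 1 ≤ Λ)
    (hb : b ≤ 1 / 8) (hb0 : 0 < b) (hbμ : b ≤ ρb / (8 * μ)) (hρ : ε₀ = ρb / 4) (n : ℕ) (u : ℝ) :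
    ScaledBound (ι := WaveParam ε₀) (scale Λ) n
      (fun p x => m3T ρb γ Λ p.α₀ p.α₃ x p.t * miT ρb μ γ Λ u p.α p.α₀ p.α₃ x p.t /
        rhoT ρb γ Λ p.α₀ p.α₃ x p.t + u * (p.α₀ * lam0 ρb γ * vthm ρb γ Λ x p.t
          - p.α₃ * lam3 ρb γ * vthp ρb γ Λ x p.t))
      (fun p x => (p.scale Λ)⁻¹ * weight ρb γ Λ (b / 2) p x) := by
  have hε₀ : 0 ≤ ε₀ := by rw [hρ]; positivity
  have hd := div_pos hρb hμ
  have h0 : lam0 ρb γ = -1 * lam3 ρb γ := by rw [lam0, lam3, neg_one_mul]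
  have h3 : lam3 ρb γ = 1 * lam3 ρb γ := (one_mul _).symm
  have hm := scaledBound_one_sub_theta_mul_wave (γ := γ) hΛ hb hb0 hd hbμ n
    (abs_α₀_le (ε₀ := ε₀)) (Or.inr rfl) (lam3_pos hρb hγ)
    (fun p x => by rw [← h0]; exact left_le_envE _ x p.t)
  have hp := scaledBound_one_sub_theta_mul_wave (γ := γ) hΛ hb hb0 hd hbμ n
    (abs_α₃_le (ε₀ := ε₀)) (Or.inl rfl) (lam3_pos hρb hγ)
    (fun p x => by rw [← h3]; exact right_le_envE _ x p.t)
  have hq := ((scaledBound_m3T (ρb := ρb) (γ := γ) hΛ hb n).mul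
    (scaledBound_velocityDeviation (γ := γ) hρb hμ hΛ hb hb0 hρ n u)).mono
    (v := fun p x => (p.scale Λ)⁻¹ * weight ρb γ Λ (b / 2) p x) (scale_pos hΛ) (3 * ε₀)
    (by positivity) (weight_mul_weight_le hΛ (by positivity))
  convert hq.add ((hm.smul (u * lam0 ρb γ)).add (hp.smul (-(u * lam3 ρb γ)))) using 1
  funext p x
  rw [mul_div_assoc, miT_div_rhoT hρb hΛ hρ, ← h0, ← h3]
  simp only [m3T, vthm, vthp]
  ring

lemma differentiable_vtheta (Λ t : ℝ) : Differentiable ℝ (fun y => vtheta Λ y t) := by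
  unfold vtheta
  fun_prop

lemma differentiable_vthm (t : ℝ) : Differentiable ℝ (fun y => vthm ρb γ Λ y t) := by
  unfold vthm vtheta
  fun_prop

lemma differentiable_vthp (t : ℝ) : Differentiable ℝ (fun y => vthp ρb γ Λ y t) := by
  unfold vthp vtheta
  fun_prop

lemma scaledBound_deriv_left (hΛ : 1 ≤ Λ) (hb : b ≤ 1 / 8) (n : ℕ) :
    ScaledBound (ι := WaveParam ε₀) (scale Λ) n
      (fun p x => p.α₀ * deriv (fun y => vthm ρb γ Λ y p.t) x)
      (fun p x => (p.scale Λ)⁻¹ * weight ρb γ Λ (b / 2) p x) := by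
  convert (scaledBound_left hΛ hb (n + 1)).deriv using 1
  funext p x
  rw [deriv_const_mul _ (differentiable_vthm p.t x)]

lemma scaledBound_deriv_right (hΛ : 1 ≤ Λ) (hb : b ≤ 1 / 8) (n : ℕ) :
    ScaledBound (ι := WaveParam ε₀) (scale Λ) n
      (fun p x => p.α₃ * deriv (fun y => vthp ρb γ Λ y p.t) x)
      (fun p x => (p.scale Λ)⁻¹ * weight ρb γ Λ (b / 2) p x) := by
  convert (scaledBound_right hΛ hb (n + 1)).deriv using 1
  funext p x
  rw [deriv_const_mul _ (differentiable_vthp p.t x)]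

lemma scaledBound_deriv_center (hΛ : 1 ≤ Λ) (hb : b ≤ 1 / 8) (n : ℕ) :
    ScaledBound (ι := WaveParam ε₀) (scale Λ) n
      (fun p x => p.α * deriv (fun y => vtheta Λ y p.t) x)
      (fun p x => (p.scale Λ)⁻¹ * weight ρb γ Λ (b / 2) p x) := by
  convert (scaledBound_center hΛ hb (n + 1)).deriv using 1
  funext p x
  rw [deriv_const_mul _ (differentiable_vtheta Λ p.t x)]

lemma scaledBound_errF (hΛ : 1 ≤ Λ) (hb : b ≤ 1 / 8) (n : ℕ) :
    ScaledBound (ι := WaveParam ε₀) (scale Λ) n (fun p x => errF ρb γ Λ p.α₀ p.α₃ x p.t)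
      (fun p x => (p.scale Λ)⁻¹ * weight ρb γ Λ (b / 2) p x) :=
  (scaledBound_deriv_left hΛ hb n).add (scaledBound_deriv_right hΛ hb n)

lemma scaledBound_errGi (hρb : 0 < ρb) (hμ : 0 < μ) (hγ : 1 < γ) (hΛ : 1 ≤ Λ)
    (hb : b ≤ 1 / 8) (hb0 : 0 < b) (hbμ : b ≤ ρb / (8 * μ)) (hρ : ε₀ = ρb / 4) (n : ℕ) (u : ℝ) :
    ScaledBound (ι := WaveParam ε₀) (scale Λ) n
      (fun p x => errGi ρb μ γ Λ u p.α p.α₀ p.α₃ x p.t)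
      (fun p x => (p.scale Λ)⁻¹ * weight ρb γ Λ (b / 2) p x) := by
  have hl := (scaledBound_deriv_left (ε₀ := ε₀) (ρb := ρb) (γ := γ) hΛ hb n).smul (-u)
  have hr := (scaledBound_deriv_right (ε₀ := ε₀) (ρb := ρb) (γ := γ) hΛ hb n).smul u
  have hv := (scaledBound_velocityDeviation (γ := γ) hρb hμ hΛ hb hb0 hρ (n + 1) u).deriv.smul (-μ)
  convert (scaledBound_deriv_center hΛ hb n).add
    ((scaledBound_convection hρb hμ hγ hΛ hb hb0 hbμ hρ n u).add ((hl.add hr).add hv)) using 1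
  funext p x
  simp only [errGi, miT_div_rhoT hρb hΛ hρ, add_sub_cancel_left]
  ring

lemma scaledBound_errG3 (hρb : 0 < ρb) (hΛ : 1 ≤ Λ) (hb : b ≤ 1 / 8) (hb0 : 0 < b)
    (hρ : ε₀ = ρb / 4) (n : ℕ) :
    ScaledBound (ι := WaveParam ε₀) (scale Λ) n
      (fun p x => errG3 ρb μ lam γ Λ p.α₀ p.α₃ x p.t)
      (fun p x => (p.scale Λ)⁻¹ * weight ρb γ Λ (b / 2) p x) := by
  have hε₀ : 0 ≤ ε₀ := by rw [hρ]; positivity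
  have hm := fun n => scaledBound_m3T (ε₀ := ε₀) (ρb := ρb) (γ := γ) hΛ hb n
  have hu := fun n => (hm n).mul (scaledBound_inv_rhoT (γ := γ) hρb hΛ hb hb0 hρ n)
  simp only [mul_one] at hu
  have hq := ((hm n).mul (hu n)).mono
    (v := fun p x => (p.scale Λ)⁻¹ * weight ρb γ Λ (b / 2) p x) (scale_pos hΛ) (3 * ε₀)
    (by positivity) (weight_mul_weight_le hΛ (by positivity))
  have hp := (ScaledBound.rpow_taylor (half_pos hρb) ⟨by linarith, by linarith⟩
    (scaledBound_perturbation_one (ρb := ρb) (γ := γ) hε₀ hΛ hb hb0)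
    (scaledBound_perturbation hΛ hb) (density_mem_Icc hΛ hρ) n γ).mono
    (v := fun p x => (p.scale Λ)⁻¹ * weight ρb γ Λ (b / 2) p x) (scale_pos hΛ) (3 * ε₀)
    (by positivity) (weight_mul_weight_le hΛ (by positivity))
  have hl := (scaledBound_deriv_left (ε₀ := ε₀) (ρb := ρb) (γ := γ) hΛ hb n).smul (lam0 ρb γ)
  have hr := (scaledBound_deriv_right (ε₀ := ε₀) (ρb := ρb) (γ := γ) hΛ hb n).smul (lam3 ρb γ)
  convert (hq.add hp).add (((hu (n + 1)).deriv.smul (-(2 * μ + lam))).add (hl.add hr)) using 1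
  funext p x
  simp only [errG3, rhoT_eq, add_sub_cancel_left, div_eq_mul_inv]
  ring

end WaveParam

/-- the error terms `F, G` of the diffusion-wave ansatz satisfy
`|∂₃^j F| + |∂₃^j G| ≤ C_j ϵ (t+Λ)^{-1-j/2} 𝔈` for all `j`, provided `ϵ ≤ ε₀`. -/
theorem stmt15 (ρb μ lam γ Λ : ℝ) (ub1 ub2 : ℝ)
    (hρb : 0 < ρb) (hμ : 0 < μ) (hml : 0 ≤ μ + lam) (hγ : 1 < γ) (hΛ : 1 ≤ Λ) :
    ∃ ε₀ : ℝ, 0 < ε₀ ∧ ∃ c₀ : ℝ, 0 < c₀ ∧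
    ∀ j : ℕ, ∃ C : ℝ, 0 < C ∧
    ∀ ϵ α₀ α₁ α₂ α₃ : ℝ, |α₀| ≤ ϵ → |α₁| ≤ ϵ → |α₂| ≤ ϵ → |α₃| ≤ ϵ → ϵ ≤ ε₀ →
    ∀ x t : ℝ, 0 ≤ t →
      |iteratedDeriv j (fun y => errF ρb γ Λ α₀ α₃ y t) x|
        + |iteratedDeriv j (fun y => errGi ρb μ γ Λ ub1 α₁ α₀ α₃ y t) x|
        + |iteratedDeriv j (fun y => errGi ρb μ γ Λ ub2 α₂ α₀ α₃ y t) x|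
        + |iteratedDeriv j (fun y => errG3 ρb μ lam γ Λ α₀ α₃ y t) x|
      ≤ C * ϵ * (t + Λ) ^ (-1 - (j:ℝ)/2) * envE ρb γ Λ c₀ x t := by
  have hb' : 0 < ρb / (8 * μ) := by positivity
  obtain ⟨b, hb0, hb, hbμ⟩ : ∃ b : ℝ, 0 < b ∧ b ≤ 1 / 8 ∧ b ≤ ρb / (8 * μ) :=
    ⟨min (1 / 8) (ρb / (8 * μ)), lt_min (by norm_num) hb', min_le_left _ _, min_le_right _ _⟩
  refine ⟨ρb / 4, by positivity, b / 2, by positivity, fun j => ?_⟩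
  obtain ⟨C₀, hC₀, h₀⟩ := (WaveParam.scaledBound_errF (ε₀ := ρb / 4) (ρb := ρb) (γ := γ)
    hΛ hb j).2 j le_rfl
  obtain ⟨C₁, hC₁, h₁⟩ := (WaveParam.scaledBound_errGi hρb hμ hγ hΛ hb hb0 hbμ rfl j ub1).2 j le_rfl
  obtain ⟨C₂, hC₂, h₂⟩ := (WaveParam.scaledBound_errGi hρb hμ hγ hΛ hb hb0 hbμ rfl j ub2).2 j le_rfl
  obtain ⟨C₃, hC₃, h₃⟩ := (WaveParam.scaledBound_errG3 (μ := μ) (lam := lam) (γ := γ)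
    hρb hΛ hb hb0 rfl j).2 j le_rfl
  refine ⟨C₀ + C₁ + C₂ + C₃ + 1, by positivity, ?_⟩
  intro ϵ α₀ α₁ α₂ α₃ hα₀ hα₁ hα₂ hα₃ hϵ x t ht
  have hτ : 0 < t + Λ := by linarith
  let p₁ : WaveParam (ρb / 4) := ⟨ϵ, α₀, α₁, α₃, t, hα₀, hα₁, hα₃, hϵ, ht⟩
  let p₂ : WaveParam (ρb / 4) := ⟨ϵ, α₀, α₂, α₃, t, hα₀, hα₂, hα₃, hϵ, ht⟩
  have hpow : (t + Λ) ^ (-1 - (j:ℝ)/2) = (Real.sqrt (t + Λ))⁻¹ ^ j * (Real.sqrt (t + Λ))⁻¹ ^ 2 := by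
    rw [← pow_add, inv_pow, Real.sqrt_eq_rpow, ← Real.rpow_natCast, ← Real.rpow_mul hτ.le,
      ← Real.rpow_neg hτ.le]
    congr 1
    push_cast
    ring
  have hw : ∀ C, C * (Real.sqrt (t + Λ))⁻¹ ^ j * ((Real.sqrt (t + Λ))⁻¹ *
      (ϵ * ((Real.sqrt (t + Λ))⁻¹ * envE ρb γ Λ (b / 2) x t))) =
      C * (ϵ * (t + Λ) ^ (-1 - (j:ℝ)/2) * envE ρb γ Λ (b / 2) x t) := fun C => by
    rw [hpow]
    ring
  have hR : 0 ≤ ϵ * (t + Λ) ^ (-1 - (j:ℝ)/2) * envE ρb γ Λ (b / 2) x t :=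
    mul_nonneg (mul_nonneg p₁.ε_nonneg (by positivity)) (WaveParam.envE_nonneg _ _ _)
  have e₀ := (h₀ p₁ x).trans_eq (hw C₀)
  have e₁ := (h₁ p₁ x).trans_eq (hw C₁)
  have e₂ := (h₂ p₂ x).trans_eq (hw C₂)
  have e₃ := (h₃ p₁ x).trans_eq (hw C₃)
  calc _ ≤ (C₀ + C₁ + C₂ + C₃) * (ϵ * (t + Λ) ^ (-1 - (j:ℝ)/2) * envE ρb γ Λ (b / 2) x t) := by
        linarith
    _ ≤ (C₀ + C₁ + C₂ + C₃ + 1) * (ϵ * (t + Λ) ^ (-1 - (j:ℝ)/2) * envE ρb γ Λ (b / 2) x t) := by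
        linarith
    _ = _ := by ring
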